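/- arXiv:1908.11082 — 2 statements merged into one kernel-verified Lean document; each statement's English description precedes it below -/
import Mathlib

section
/- Mixed ℓ₂/ℓ₁ error bound for the block Dantzig selector (BDS) with block k-sparse signals: let q > 1 be real, k ≥ 1, x block k-sparse, μ ≥ 0, ε with ‖Aᵀε‖_{2,∞} ≤ μ, and y = A x + ε. Let x̂ satisfy ‖Aᵀ(y − A x̂)‖_{2,∞} ≤ μ and ‖x̂‖_{2,1} ≤ ‖z‖_{2,1} for every z with ‖Aᵀ(y − A z)‖_{2,∞} ≤ μ. Suppose β > 0 is such that ‖A z‖₂ ≥ β·‖z‖_{2,q} for every z with ‖z‖_{2,1} ≤ 2·k^{1-1/q}·‖z‖_{2,q}. Then ‖x̂ − x‖_{2,1} ≤ 8·k^{2-2/q}·μ/β². -/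
open scoped BigOperators

noncomputable section

/-- Mixed ℓ₂/ℓ₁ norm of a block signal: sum of the Euclidean norms of the blocks. -/
def mnorm1 {p n : ℕ} (x : Fin p → EuclideanSpace ℝ (Fin n)) : ℝ := ∑ i, ‖x i‖

/-- Mixed ℓ₂/ℓ_q norm of a block signal. -/
def mnorm {p n : ℕ} (q : ℝ) (x : Fin p → EuclideanSpace ℝ (Fin n)) : ℝ :=
  (∑ i, ‖x i‖ ^ q) ^ (1 / q)

/-- Mixed ℓ₂/ℓ_∞ norm of a block signal: the largest block norm. -/
def mnormInf {p n : ℕ} (x : Fin p → EuclideanSpace ℝ (Fin n)) : ℝ := ⨆ i, ‖x i‖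

/-- Each block norm is bounded by the mixed ℓ₂/ℓ_∞ norm. -/
theorem norm_le_mnormInf {p n : ℕ} (x : Fin p → EuclideanSpace ℝ (Fin n)) (i : Fin p) :
    ‖x i‖ ≤ mnormInf x :=
  le_ciSup (f := fun i => ‖x i‖) (Set.finite_range _).bddAbove i

theorem mnorm_nonneg {p n : ℕ} (q : ℝ) (x : Fin p → EuclideanSpace ℝ (Fin n)) :
    0 ≤ mnorm q x :=
  Real.rpow_nonneg (Finset.sum_nonneg fun i _ => Real.rpow_nonneg (norm_nonneg (x i)) q) _

/-- The sum of at most `k` block norms is controlled by the mixed ℓ₂/ℓ_q norm. -/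
theorem sum_norm_le_rpow_mul_mnorm {p n : ℕ} {q : ℝ} (hq : 1 ≤ q) {k : ℕ} {S : Finset (Fin p)}
    (hS : S.card ≤ k) (x : Fin p → EuclideanSpace ℝ (Fin n)) :
    ∑ i ∈ S, ‖x i‖ ≤ (k : ℝ) ^ (1 - 1 / q) * mnorm q x := by
  have hq0 : 0 < q := by linarith
  have hsum0 : 0 ≤ ∑ i ∈ S, ‖x i‖ := Finset.sum_nonneg fun i _ => norm_nonneg (x i)
  have hT0 : 0 ≤ ∑ i, ‖x i‖ ^ q :=
    Finset.sum_nonneg fun i _ => Real.rpow_nonneg (norm_nonneg (x i)) q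
  have hpow : (∑ i ∈ S, ‖x i‖) ^ q ≤ (k : ℝ) ^ (q - 1) * ∑ i, ‖x i‖ ^ q := by
    refine (Real.rpow_sum_le_const_mul_sum_rpow_of_nonneg S hq
      fun i _ => norm_nonneg (x i)).trans ?_
    refine mul_le_mul ?_ ?_ (Finset.sum_nonneg fun i _ => Real.rpow_nonneg (norm_nonneg (x i)) q)
      (Real.rpow_nonneg k.cast_nonneg _)
    · exact Real.rpow_le_rpow (Nat.cast_nonneg _) (by exact_mod_cast hS) (by linarith)
    · exact Finset.sum_le_sum_of_subset_of_nonneg (Finset.subset_univ S)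
        fun i _ _ => Real.rpow_nonneg (norm_nonneg (x i)) q
  have hroot := Real.rpow_le_rpow (Real.rpow_nonneg hsum0 q) hpow (one_div_nonneg.2 hq0.le)
  rw [← Real.rpow_mul hsum0, mul_one_div_cancel hq0.ne', Real.rpow_one,
    Real.mul_rpow (Real.rpow_nonneg k.cast_nonneg _) hT0, ← Real.rpow_mul k.cast_nonneg] at hroot
  have hexp : (q - 1) * (1 / q) = 1 - 1 / q := by field_simp
  rwa [hexp] at hroot

/-- If `x` is supported on `S` and `z` has no larger ℓ₂/ℓ₁ norm, then at least half of the ℓ₂/ℓ₁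
norm of `z - x` is carried by `S`. -/
theorem mnorm1_sub_le_two_mul_sum {p n : ℕ} {x z : Fin p → EuclideanSpace ℝ (Fin n)}
    {S : Finset (Fin p)} (hx : ∀ i ∉ S, x i = 0) (h : mnorm1 z ≤ mnorm1 x) :
    mnorm1 (z - x) ≤ 2 * ∑ i ∈ S, ‖(z - x) i‖ := by
  have key : ∀ i, ‖(z - x) i‖ + ‖x i‖ ≤ ‖z i‖ + if i ∈ S then 2 * ‖(z - x) i‖ else 0 := by
    intro i
    rw [Pi.sub_apply]
    split_ifs with hi
    · have := norm_sub_rev (z i) (x i)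
      have := norm_sub_norm_le (x i) (z i)
      linarith
    · simp [hx i hi]
  have hsum := Finset.sum_le_sum fun i (_ : i ∈ Finset.univ) => key i
  rw [Finset.sum_add_distrib, Finset.sum_add_distrib, Finset.sum_ite_mem, Finset.univ_inter,
    ← Finset.mul_sum] at hsum
  unfold mnorm1 at h ⊢
  linarith

/-- Block Hölder inequality. -/
theorem inner_le_mnorm1_mul {p n : ℕ} (u v : PiLp 2 (fun _ : Fin p => EuclideanSpace ℝ (Fin n)))
    {c : ℝ} (hv : ∀ i, ‖v i‖ ≤ c) : inner ℝ u v ≤ mnorm1 u * c := by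
  rw [PiLp.inner_apply, mnorm1, Finset.sum_mul]
  exact Finset.sum_le_sum fun i _ => (real_inner_le_norm _ _).trans
    (mul_le_mul_of_nonneg_left (hv i) (norm_nonneg _))

/-- Mixed ℓ₂/ℓ₁ error bound for the block Dantzig selector with block k-sparse signals. -/
theorem stmt_8 {p n m : ℕ}
    (A : PiLp 2 (fun _ : Fin p => EuclideanSpace ℝ (Fin n)) →L[ℝ] EuclideanSpace ℝ (Fin m))
    (q : ℝ) (hq : 1 < q) (k : ℕ) (hk : 1 ≤ k)
    (x : PiLp 2 (fun _ : Fin p => EuclideanSpace ℝ (Fin n)))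
    (hx : ∃ S : Finset (Fin p), S.card ≤ k ∧ ∀ i ∉ S, x i = 0)
    (μ : ℝ) (hμ : 0 ≤ μ)
    (ε : EuclideanSpace ℝ (Fin m))
    (hε : mnormInf (ContinuousLinearMap.adjoint A ε) ≤ μ)
    (y : EuclideanSpace ℝ (Fin m)) (hy : y = A x + ε)
    (xh : PiLp 2 (fun _ : Fin p => EuclideanSpace ℝ (Fin n)))
    (hfeas : mnormInf (ContinuousLinearMap.adjoint A (y - A xh)) ≤ μ)
    (hmin : ∀ z : PiLp 2 (fun _ : Fin p => EuclideanSpace ℝ (Fin n)),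
      mnormInf (ContinuousLinearMap.adjoint A (y - A z)) ≤ μ → mnorm1 xh ≤ mnorm1 z)
    (β : ℝ) (hβ : 0 < β)
    (hcmsv : ∀ z : PiLp 2 (fun _ : Fin p => EuclideanSpace ℝ (Fin n)),
      mnorm1 z ≤ 2 * (k : ℝ) ^ (1 - 1 / q) * mnorm q z → β * mnorm q z ≤ ‖A z‖) :
    mnorm1 (xh - x) ≤ 8 * (k : ℝ) ^ (2 - 2 / q) * μ / β ^ 2 := by
  obtain ⟨S, hS, hxS⟩ := hx
  set c : ℝ := (k : ℝ) ^ (1 - 1 / q) with hc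
  have hc0 : 0 ≤ c := Real.rpow_nonneg k.cast_nonneg _
  have hcc : (k : ℝ) ^ (2 - 2 / q) = c * c := by
    rw [hc, ← Real.rpow_add (by exact_mod_cast hk)]
    congr 1
    ring
  have hle : mnorm1 xh ≤ mnorm1 x := hmin x (by simpa [hy] using hε)
  have hcone : mnorm1 (xh - x) ≤ 2 * c * mnorm q (xh - x) := by
    have h₁ := mnorm1_sub_le_two_mul_sum hxS hle
    have h₂ := sum_norm_le_rpow_mul_mnorm hq.le hS (xh - x)
    simp only [WithLp.ofLp_sub] at h₁ h₂ ⊢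
    linarith
  have hlow : β * mnorm q (xh - x) ≤ ‖A (xh - x)‖ := hcmsv (xh - x) hcone
  have hgram : ∀ i, ‖ContinuousLinearMap.adjoint A (A (xh - x)) i‖ ≤ 2 * μ := by
    intro i
    have hsplit : ContinuousLinearMap.adjoint A (A (xh - x)) =
        ContinuousLinearMap.adjoint A ε - ContinuousLinearMap.adjoint A (y - A xh) := by
      rw [← map_sub, hy, map_sub]
      congr 1
      abel
    rw [hsplit, PiLp.sub_apply]
    have h₁ := (norm_le_mnormInf (ContinuousLinearMap.adjoint A ε) i).trans hε
    have h₂ := (norm_le_mnormInf (ContinuousLinearMap.adjoint A (y - A xh)) i).trans hfeas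
    exact (norm_sub_le _ _).trans (by linarith)
  have hup : ‖A (xh - x)‖ ^ 2 ≤ mnorm1 (xh - x) * (2 * μ) := by
    rw [← real_inner_self_eq_norm_sq, ← ContinuousLinearMap.adjoint_inner_right]
    exact inner_le_mnorm1_mul _ _ hgram
  have hN0 : 0 ≤ mnorm q (xh - x) := mnorm_nonneg q _
  set N := mnorm q (xh - x)
  have hN : N * β ^ 2 ≤ 4 * c * μ := by
    rcases hN0.eq_or_lt with h0 | hpos
    · rw [← h0, zero_mul]
      positivity
    · refine le_of_mul_le_mul_right ?_ hpos
      have hsq : (β * N) ^ 2 ≤ ‖A (xh - x)‖ ^ 2 := pow_le_pow_left₀ (by positivity) hlow 2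
      have hmu := mul_le_mul_of_nonneg_right hcone (show 0 ≤ 2 * μ by linarith)
      linarith
  rw [hcc, le_div_iff₀ (by positivity)]
  calc mnorm1 (xh - x) * β ^ 2 ≤ 2 * c * N * β ^ 2 := by gcongr
    _ = 2 * c * (N * β ^ 2) := by ring
    _ ≤ 2 * c * (4 * c * μ) := by gcongr
    _ = 8 * (c * c) * μ := by ring
end
end

section
/- For any real q with 2 ≤ q < ∞, any real s with 1 ≤ s ≤ p^{q/(2(q-1))}, and any linear measurement map A, β_{q,s}(A) ≥ β_{2,s^{2(q-1)/q}}(A). -/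
open scoped BigOperators

noncomputable section

/-- The q-ratio block sparsity k_q(x) = (‖x‖_{2,1}/‖x‖_{2,q})^{q/(q-1)}. -/
def blockSparsity {p n : ℕ} (q : ℝ) (x : Fin p → EuclideanSpace ℝ (Fin n)) : ℝ :=
  (mnorm1 x / mnorm q x) ^ (q / (q - 1))

/-- The q-ratio block constrained minimal singular value of a measurement map. -/
def bcmsv {p n m : ℕ} (q s : ℝ)
    (A : (Fin p → EuclideanSpace ℝ (Fin n)) →ₗ[ℝ] EuclideanSpace ℝ (Fin m)) : ℝ :=
  sInf {r : ℝ | ∃ z : Fin p → EuclideanSpace ℝ (Fin n),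
    z ≠ 0 ∧ blockSparsity q z ≤ s ∧ r = ‖A z‖ / mnorm q z}

/-- Monotonicity of `ℓ_r` quasi-norms of a finite nonnegative family in the exponent. -/
theorem rpow_sum_rpow_le_of_exponent_le {ι : Type*} (t : Finset ι) (a : ι → ℝ)
    (ha : ∀ i ∈ t, 0 ≤ a i) {r q : ℝ} (hr : 0 < r) (hrq : r ≤ q) :
    (∑ i ∈ t, a i ^ q) ^ (1 / q) ≤ (∑ i ∈ t, a i ^ r) ^ (1 / r) := by
  have hq : 0 < q := hr.trans_le hrq
  set S := ∑ i ∈ t, a i ^ r with hS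
  have hS0 : 0 ≤ S := Finset.sum_nonneg fun i hi => Real.rpow_nonneg (ha i hi) _
  have hle : ∀ i ∈ t, a i ≤ S ^ (1 / r) := fun i hi => by
    rw [one_div, Real.le_rpow_inv_iff_of_pos (ha i hi) hS0 hr]
    exact Finset.single_le_sum (f := fun i => a i ^ r)
      (fun j hj => Real.rpow_nonneg (ha j hj) _) hi
  have hterm : ∀ i ∈ t, a i ^ q ≤ a i ^ r * S ^ ((q - r) / r) := fun i hi => by
    calc a i ^ q = a i ^ r * a i ^ (q - r) := by
          rw [← Real.rpow_add_of_nonneg (ha i hi) hr.le (sub_nonneg.2 hrq)]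
          congr 1; ring
      _ ≤ a i ^ r * (S ^ (1 / r)) ^ (q - r) :=
          mul_le_mul_of_nonneg_left
            (Real.rpow_le_rpow (ha i hi) (hle i hi) (sub_nonneg.2 hrq))
            (Real.rpow_nonneg (ha i hi) _)
      _ = a i ^ r * S ^ ((q - r) / r) := by
          rw [← Real.rpow_mul hS0]; congr 2; ring
  have hsum : ∑ i ∈ t, a i ^ q ≤ S ^ (q / r) := by
    calc ∑ i ∈ t, a i ^ q ≤ ∑ i ∈ t, a i ^ r * S ^ ((q - r) / r) := Finset.sum_le_sum hterm
      _ = S ^ (1 : ℝ) * S ^ ((q - r) / r) := by rw [← Finset.sum_mul, Real.rpow_one]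
      _ = S ^ (q / r) := by
          rw [← Real.rpow_add_of_nonneg hS0 zero_le_one (div_nonneg (sub_nonneg.2 hrq) hr.le)]
          congr 1; field_simp; ring
  calc (∑ i ∈ t, a i ^ q) ^ (1 / q) ≤ (S ^ (q / r)) ^ (1 / q) :=
        Real.rpow_le_rpow (Finset.sum_nonneg fun i hi => Real.rpow_nonneg (ha i hi) _) hsum
          (by positivity)
    _ = S ^ (1 / r) := by rw [← Real.rpow_mul hS0]; congr 1; field_simp

theorem mnorm1_nonneg {p n : ℕ} (x : Fin p → EuclideanSpace ℝ (Fin n)) : 0 ≤ mnorm1 x :=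
  Finset.sum_nonneg fun _ _ => norm_nonneg _

theorem mnorm_pos {p n : ℕ} (q : ℝ) {x : Fin p → EuclideanSpace ℝ (Fin n)} (hx : x ≠ 0) :
    0 < mnorm q x := by
  obtain ⟨i, hi⟩ := Function.ne_iff.1 hx
  exact Real.rpow_pos_of_pos (Finset.sum_pos' (fun j _ => Real.rpow_nonneg (norm_nonneg _) _)
    ⟨i, Finset.mem_univ i, Real.rpow_pos_of_pos (norm_pos_iff.2 hi) _⟩) _

theorem mnorm_le_mnorm_of_exponent_le {p n : ℕ} {r q : ℝ} (hr : 0 < r) (hrq : r ≤ q)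
    (x : Fin p → EuclideanSpace ℝ (Fin n)) : mnorm q x ≤ mnorm r x :=
  rpow_sum_rpow_le_of_exponent_le _ _ (fun _ _ => norm_nonneg _) hr hrq

theorem mnorm1_single {p n : ℕ} (i : Fin p) (v : EuclideanSpace ℝ (Fin n)) :
    mnorm1 (Pi.single i v) = ‖v‖ := by
  rw [mnorm1, Finset.sum_eq_single i] <;> simp +contextual

theorem mnorm_single {p n : ℕ} {q : ℝ} (hq : 0 < q) (i : Fin p) (v : EuclideanSpace ℝ (Fin n)) :
    mnorm q (Pi.single i v) = ‖v‖ := by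
  rw [mnorm, Finset.sum_eq_single i]
  · rw [Pi.single_eq_same, one_div, Real.rpow_rpow_inv (norm_nonneg v) hq.ne']
  · intro j _ hj
    rw [Pi.single_eq_of_ne hj, norm_zero, Real.zero_rpow hq.ne']
  · simp

theorem blockSparsity_single {p n : ℕ} {q : ℝ} (hq : 0 < q) (i : Fin p)
    {v : EuclideanSpace ℝ (Fin n)} (hv : v ≠ 0) : blockSparsity q (Pi.single i v) = 1 := by
  rw [blockSparsity, mnorm1_single, mnorm_single hq, div_self (norm_ne_zero_iff.2 hv),
    Real.one_rpow]

/-- A bound on the `q`-ratio block sparsity gives one on the `2`-ratio block sparsity. -/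
theorem blockSparsity_two_le {p n : ℕ} {q s : ℝ} (hq : 2 ≤ q)
    {z : Fin p → EuclideanSpace ℝ (Fin n)} (hz : z ≠ 0) (h : blockSparsity q z ≤ s) :
    blockSparsity 2 z ≤ s ^ (2 * (q - 1) / q) := by
  have hq0 : 0 < q := by linarith
  have hq1 : 0 < q - 1 := by linarith
  have hratio : 0 ≤ mnorm1 z / mnorm q z := div_nonneg (mnorm1_nonneg z) (mnorm_pos q hz).le
  calc blockSparsity 2 z = (mnorm1 z / mnorm 2 z) ^ (2 : ℝ) := by
        rw [blockSparsity]; norm_num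
    _ ≤ (mnorm1 z / mnorm q z) ^ (2 : ℝ) :=
        Real.rpow_le_rpow (div_nonneg (mnorm1_nonneg z) (mnorm_pos 2 hz).le)
          (div_le_div_of_nonneg_left (mnorm1_nonneg z) (mnorm_pos q hz)
            (mnorm_le_mnorm_of_exponent_le two_pos hq z)) two_pos.le
    _ = blockSparsity q z ^ (2 * (q - 1) / q) := by
        rw [blockSparsity, ← Real.rpow_mul hratio]; congr 1; field_simp
    _ ≤ s ^ (2 * (q - 1) / q) :=
        Real.rpow_le_rpow (Real.rpow_nonneg hratio _) h (by positivity)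

/-- For 2 ≤ q < ∞ and 1 ≤ s ≤ p^{q/(2(q-1))} : β_{q,s}(A) ≥ β_{2,s^{2(q-1)/q}}(A). -/
theorem stmt_16 {p n m : ℕ}
    (A : (Fin p → EuclideanSpace ℝ (Fin n)) →ₗ[ℝ] EuclideanSpace ℝ (Fin m))
    (q : ℝ) (hq : 2 ≤ q)
    (s : ℝ) (hs1 : 1 ≤ s) (hs2 : s ≤ (p : ℝ) ^ (q / (2 * (q - 1)))) :
    bcmsv 2 (s ^ (2 * (q - 1) / q)) A ≤ bcmsv q s A := by
  have hbdd : BddBelow {r : ℝ | ∃ z : Fin p → EuclideanSpace ℝ (Fin n),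
      z ≠ 0 ∧ blockSparsity 2 z ≤ s ^ (2 * (q - 1) / q) ∧ r = ‖A z‖ / mnorm 2 z} := by
    refine ⟨0, ?_⟩
    rintro r ⟨z, hz, -, rfl⟩
    exact div_nonneg (norm_nonneg _) (mnorm_pos 2 hz).le
  by_cases hne : ∃ z : Fin p → EuclideanSpace ℝ (Fin n), z ≠ 0
  · obtain ⟨w, hw⟩ := hne
    obtain ⟨i, hi⟩ := Function.ne_iff.1 hw
    refine le_csInf ⟨_, Pi.single i (w i), by simpa using hi, ?_, rfl⟩ ?_
    · rwa [blockSparsity_single (by linarith) i hi]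
    · rintro r ⟨z, hz, hzs, rfl⟩
      exact (csInf_le hbdd ⟨z, hz, blockSparsity_two_le hq hz hzs, rfl⟩).trans
        (div_le_div_of_nonneg_left (norm_nonneg _) (mnorm_pos q hz)
          (mnorm_le_mnorm_of_exponent_le two_pos hq z))
  · push Not at hne
    simp [bcmsv, hne]
end
end
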